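/- arXiv:2012.01898 — 3 statements merged into one kernel-verified Lean document; each statement's English description precedes it below -/
import Mathlib

section
/- Two-sided algebraic bound for the stabilized discrete inf-sup constant (η = 1): Let A be an n × n real symmetric positive definite matrix, M a p × p real symmetric positive definite matrix, B a p × n real matrix, and S a p × p real symmetric positive semidefinite matrix. For q ∈ ℝᵖ with q ≠ 0, define R(q) := ( sup_{v ∈ ℝⁿ, v ≠ 0} |q · (B v)| / √(v · (A v)) + √(q · (S q)) ) / √(q · (M q)) and λ(q) := ( q · ((B A⁻¹ Bᵀ + S) q) ) / ( q · (M q) ). Then √(λ(q)) ≤ R(q) ≤ √(2 λ(q)) for every q ≠ 0, and consequently, for every set U of nonzero vectors in ℝᵖ, √( inf_{q ∈ U} λ(q) ) ≤ inf_{q ∈ U} R(q) ≤ √2 · √( inf_{q ∈ U} λ(q) ). -/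
open Matrix

namespace Matrix.PosDef

variable {ι : Type*} [Fintype ι] [DecidableEq ι] {A : Matrix ι ι ℝ}

/-- Cauchy–Schwarz inequality between the energy norm of `A` and its dual norm. -/
lemma sq_dotProduct_le (hA : A.PosDef) (b v : ι → ℝ) :
    (b ⬝ᵥ v) ^ 2 ≤ (b ⬝ᵥ (A⁻¹ *ᵥ b)) * (v ⬝ᵥ (A *ᵥ v)) := by
  rcases eq_or_ne v 0 with rfl | hv
  · simp
  have hAx : A *ᵥ (A⁻¹ *ᵥ b) = b := by
    rw [mulVec_mulVec, mul_nonsing_inv _ ((isUnit_iff_isUnit_det A).1 hA.isUnit), one_mulVec]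
  have hT : Aᵀ = A := by simpa using hA.isHermitian.eq
  have hpos : 0 < v ⬝ᵥ (A *ᵥ v) := by simpa using hA.dotProduct_mulVec_pos hv
  set x := A⁻¹ *ᵥ b
  have hxv : x ⬝ᵥ (A *ᵥ v) = b ⬝ᵥ v := by
    rw [dotProduct_mulVec, ← mulVec_transpose, hT, hAx]
  set a := v ⬝ᵥ (A *ᵥ v) with ha
  set c := b ⬝ᵥ v with hc
  have h0 : 0 ≤ (a • x - c • v) ⬝ᵥ (A *ᵥ (a • x - c • v)) := by
    simpa using hA.posSemidef.dotProduct_mulVec_nonneg (a • x - c • v)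
  have h1 : (a • x - c • v) ⬝ᵥ (A *ᵥ (a • x - c • v)) = a * ((b ⬝ᵥ x) * a - c ^ 2) := by
    simp only [mulVec_sub, mulVec_smul, hAx, sub_dotProduct, dotProduct_sub, smul_dotProduct,
      dotProduct_smul, smul_eq_mul, hxv, dotProduct_comm x b, dotProduct_comm v b, ← ha, ← hc]
    ring
  rw [h1] at h0
  linarith [nonneg_of_mul_nonneg_right h0 hpos]

/-- The dual of the energy norm of `A` is the energy norm of `A⁻¹`. -/
lemma iSup_abs_dotProduct_div_sqrt (hA : A.PosDef) (b : ι → ℝ) :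
    (⨆ v : {v : ι → ℝ // v ≠ 0}, |b ⬝ᵥ v.1| / √(v.1 ⬝ᵥ (A *ᵥ v.1))) =
      √(b ⬝ᵥ (A⁻¹ *ᵥ b)) := by
  have hle (v : {v : ι → ℝ // v ≠ 0}) :
      |b ⬝ᵥ v.1| / √(v.1 ⬝ᵥ (A *ᵥ v.1)) ≤ √(b ⬝ᵥ (A⁻¹ *ᵥ b)) := by
    have hpos : 0 < v.1 ⬝ᵥ (A *ᵥ v.1) := by simpa using hA.dotProduct_mulVec_pos v.2
    rw [div_le_iff₀ (Real.sqrt_pos.2 hpos), ← Real.sqrt_mul' _ hpos.le]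
    exact Real.abs_le_sqrt (hA.sq_dotProduct_le b v.1)
  apply le_antisymm
  · exact Real.iSup_le hle (Real.sqrt_nonneg _)
  · by_cases hb : b = 0
    · subst hb
      simp
    have hAx : A *ᵥ (A⁻¹ *ᵥ b) = b := by
      rw [mulVec_mulVec, mul_nonsing_inv _ ((isUnit_iff_isUnit_det A).1 hA.isUnit), one_mulVec]
    have hx : A⁻¹ *ᵥ b ≠ 0 := fun h => hb (by rw [← hAx, h, mulVec_zero])
    have hpos : 0 < b ⬝ᵥ (A⁻¹ *ᵥ b) := by simpa using hA.inv.dotProduct_mulVec_pos hb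
    refine le_ciSup_of_le ⟨_, Set.forall_mem_range.2 hle⟩ ⟨A⁻¹ *ᵥ b, hx⟩ (le_of_eq ?_)
    simp only [hAx]
    rw [dotProduct_comm (A⁻¹ *ᵥ b) b, abs_of_pos hpos, Real.div_sqrt]

end Matrix.PosDef

lemma Real.sqrt_add_sqrt_le_sqrt_two_mul {x y : ℝ} (hx : 0 ≤ x) (hy : 0 ≤ y) :
    √x + √y ≤ √(2 * (x + y)) := by
  apply Real.le_sqrt_of_sq_le
  nlinarith [sq_nonneg (√x - √y), Real.sq_sqrt hx, Real.sq_sqrt hy]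

lemma Real.sqrt_add_le_sqrt_add_sqrt {x y : ℝ} (hx : 0 ≤ x) (hy : 0 ≤ y) :
    √(x + y) ≤ √x + √y := by
  rw [Real.sqrt_le_left (by positivity)]
  nlinarith [Real.sq_sqrt hx, Real.sq_sqrt hy, mul_nonneg (Real.sqrt_nonneg x) (Real.sqrt_nonneg y)]

/-- A pointwise bound `√f ≤ g ≤ √(2 f)` passes to infima. -/
lemma Real.sqrt_iInf_le_iInf_and_le {ι : Sort*} {f g : ι → ℝ} (hf : ∀ i, 0 ≤ f i)
    (h : ∀ i, √(f i) ≤ g i ∧ g i ≤ √(2 * f i)) :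
    √(⨅ i, f i) ≤ ⨅ i, g i ∧ ⨅ i, g i ≤ √2 * √(⨅ i, f i) := by
  rcases isEmpty_or_nonempty ι with hι | hι
  · simp [Real.iInf_of_isEmpty]
  have hg (i : ι) : 0 ≤ g i := (Real.sqrt_nonneg _).trans (h i).1
  have hfb : BddBelow (Set.range f) := ⟨0, Set.forall_mem_range.2 hf⟩
  have hgb : BddBelow (Set.range g) := ⟨0, Set.forall_mem_range.2 hg⟩
  refine ⟨le_ciInf fun i => (Real.sqrt_le_sqrt (ciInf_le hfb i)).trans (h i).1, ?_⟩
  rw [← Real.sqrt_mul zero_le_two]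
  apply Real.le_sqrt_of_sq_le
  have key : (⨅ i, g i) ^ 2 / 2 ≤ ⨅ i, f i := le_ciInf fun i => by
    have h1 : ⨅ i, g i ≤ √(2 * f i) := (ciInf_le hgb i).trans (h i).2
    have h2 := (Real.le_sqrt (Real.iInf_nonneg hg) (by linarith [hf i])).1 h1
    linarith
  linarith

/-- **Two-sided algebraic bound for the stabilized discrete inf-sup constant (`η = 1`).**
With `A` (velocity stiffness) and `M` (pressure mass) symmetric positive definite,
`B` the discrete divergence matrix, and `S` symmetric positive semidefinite
(pressure-jump stabilization), define for `q ≠ 0` the stabilized inf-sup ratio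
`R(q) = (sup_{v ≠ 0} |q · B v| / √(v · A v) + √(q · S q)) / √(q · M q)` and the
Rayleigh quotient `λ(q) = q · ((B A⁻¹ Bᵀ + S) q) / (q · M q)`.  Then
`√(λ q) ≤ R q ≤ √(2 λ q)` for every `q ≠ 0`, and for every set `U` of nonzero vectors,
`√(inf_U λ) ≤ inf_U R ≤ √2 · √(inf_U λ)`. -/
theorem stabilized_infsup_two_sided
    (n p : ℕ)
    (A : Matrix (Fin n) (Fin n) ℝ) (hA : A.PosDef)
    (M : Matrix (Fin p) (Fin p) ℝ) (hM : M.PosDef)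
    (B : Matrix (Fin p) (Fin n) ℝ)
    (S : Matrix (Fin p) (Fin p) ℝ) (hS : S.PosSemidef)
    (R lam : (Fin p → ℝ) → ℝ)
    (hR : ∀ q : Fin p → ℝ, R q =
      ((⨆ v : {v : Fin n → ℝ // v ≠ 0},
          |q ⬝ᵥ (B *ᵥ v.1)| / Real.sqrt (v.1 ⬝ᵥ (A *ᵥ v.1))) +
        Real.sqrt (q ⬝ᵥ (S *ᵥ q))) / Real.sqrt (q ⬝ᵥ (M *ᵥ q)))
    (hlam : ∀ q : Fin p → ℝ, lam q =
      (q ⬝ᵥ ((B * A⁻¹ * Bᵀ + S) *ᵥ q)) / (q ⬝ᵥ (M *ᵥ q))) :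
    (∀ q : Fin p → ℝ, q ≠ 0 →
      Real.sqrt (lam q) ≤ R q ∧ R q ≤ Real.sqrt (2 * lam q)) ∧
    (∀ U : Set (Fin p → ℝ), (∀ q ∈ U, q ≠ 0) →
      Real.sqrt (⨅ q : U, lam q.1) ≤ (⨅ q : U, R q.1) ∧
        (⨅ q : U, R q.1) ≤ Real.sqrt 2 * Real.sqrt (⨅ q : U, lam q.1)) := by
  have hA' (q : Fin p → ℝ) : 0 ≤ (Bᵀ *ᵥ q) ⬝ᵥ (A⁻¹ *ᵥ (Bᵀ *ᵥ q)) := by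
    simpa using hA.inv.posSemidef.dotProduct_mulVec_nonneg (Bᵀ *ᵥ q)
  have hS' (q : Fin p → ℝ) : 0 ≤ q ⬝ᵥ (S *ᵥ q) := by
    simpa using hS.dotProduct_mulVec_nonneg q
  have hM' (q : Fin p → ℝ) : 0 ≤ q ⬝ᵥ (M *ᵥ q) := by
    simpa using hM.posSemidef.dotProduct_mulVec_nonneg q
  have hR' (q : Fin p → ℝ) : R q = (√((Bᵀ *ᵥ q) ⬝ᵥ (A⁻¹ *ᵥ (Bᵀ *ᵥ q))) + √(q ⬝ᵥ (S *ᵥ q))) /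
      √(q ⬝ᵥ (M *ᵥ q)) := by
    simp only [hR, ← hA.iSup_abs_dotProduct_div_sqrt, dotProduct_mulVec q B, mulVec_transpose]
  have hlam' (q : Fin p → ℝ) : lam q =
      ((Bᵀ *ᵥ q) ⬝ᵥ (A⁻¹ *ᵥ (Bᵀ *ᵥ q)) + q ⬝ᵥ (S *ᵥ q)) / (q ⬝ᵥ (M *ᵥ q)) := by
    rw [hlam, add_mulVec, dotProduct_add, ← mulVec_mulVec, ← mulVec_mulVec, dotProduct_mulVec q B,
      ← mulVec_transpose]
  have hbound (q : Fin p → ℝ) : √(lam q) ≤ R q ∧ R q ≤ √(2 * lam q) := by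
    rw [hR', hlam', ← mul_div_assoc, Real.sqrt_div' _ (hM' q), Real.sqrt_div' _ (hM' q)]
    constructor
    · gcongr
      exact Real.sqrt_add_le_sqrt_add_sqrt (hA' q) (hS' q)
    · gcongr
      exact Real.sqrt_add_sqrt_le_sqrt_two_mul (hA' q) (hS' q)
  have hlam0 (q : Fin p → ℝ) : 0 ≤ lam q := by
    rw [hlam']
    exact div_nonneg (add_nonneg (hA' q) (hS' q)) (hM' q)
  exact ⟨fun q _ => hbound q, fun U _ =>
    Real.sqrt_iInf_le_iInf_and_le (fun q => hlam0 q.1) fun q => hbound q.1⟩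
end

section
/- Polynomial trace inverse inequality (reference-element form of Lemma 3.2): For every dimension d ≥ 1 there exists a constant C > 0, depending only on d, such that for every integer r ≥ 1 and every real polynomial v in d variables of total degree at most r, ∫_{∂Δ_d} v(x)² dH^{d−1}(x) ≤ C r² ∫_{Δ_d} v(x)² dx, where Δ_d = { x ∈ ℝᵈ : xᵢ ≥ 0 for all i, and x₁ + ⋯ + x_d ≤ 1 } is the standard unit simplex, ∂Δ_d is its topological boundary, H^{d−1} is the (d−1)-dimensional Hausdorff measure, and dx is the Lebesgue measure on ℝᵈ. -/
open MeasureTheory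

open Polynomial in
/-- The first column of the inverse of the `(r + 1) × (r + 1)` Hilbert matrix exists and has corner
entry `(r + 1) ^ 2`. -/
theorem exists_sum_div_eq_ite (r : ℕ) :
    ∃ c : ℕ → ℝ, c 0 = ((r : ℝ) + 1) ^ 2 ∧ ∀ k ≤ r,
      ∑ j ∈ Finset.range (r + 1), c j / ((k : ℝ) + j + 1) = if k = 0 then 1 else 0 := by
  classical
  let s := Finset.range (r + 1)
  let w : ℕ → ℝ := fun j => -((j : ℝ) + 1)
  let Q : ℝ[X] := ∏ i ∈ Finset.range r, (X - C ((i : ℝ) + 1))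
  have hQ (x : ℝ) : Q.eval x = ∏ i ∈ Finset.range r, (x - ((i : ℝ) + 1)) := by
    simp [Q, eval_prod]
  have hw : Set.InjOn w s := by
    intro a _ b _ h
    simpa [w] using h
  have hdeg : Q.degree < s.card := by
    have : Q.natDegree = r := by
      simpa only [Finset.card_range] using natDegree_finsetProd_X_sub_C_eq_card (Finset.range r) fun i : ℕ => (i : ℝ) + 1
    have h0 : Q.degree ≤ (r : ℕ) := this ▸ degree_le_natDegree
    refine h0.trans_lt ?_
    simp only [s, Finset.card_range]
    exact_mod_cast Nat.lt_succ_self r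
  have hfact : ∏ i ∈ Finset.range r, ((i : ℝ) + 1) = r.factorial := by
    rw [← Finset.prod_range_add_one_eq_factorial]; push_cast; rfl
  have hfact' : ∏ i ∈ Finset.range (r + 1), ((i : ℝ) + 1) = (r + 1).factorial := by
    rw [← Finset.prod_range_add_one_eq_factorial]; push_cast; rfl
  have hQ0 : Q.eval 0 = (-1) ^ r * (r.factorial : ℝ) := by
    rw [hQ, ← hfact, ← Finset.card_range r, ← Finset.prod_const, Finset.card_range,
      ← Finset.prod_mul_distrib]
    simp
  have hQ1 : Q.eval (-1) = (-1) ^ r * ((r + 1).factorial : ℝ) := by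
    rw [hQ, ← hfact', Finset.prod_range_succ', ← Finset.card_range r, ← Finset.prod_const,
      Finset.card_range]
    simp only [Nat.cast_zero, zero_add, mul_one]
    rw [← Finset.prod_mul_distrib]
    refine Finset.prod_congr rfl fun i _ => ?_
    push_cast; ring
  have hN (x : ℝ) : (Lagrange.nodal s w).eval x = ∏ j ∈ s, (x + ((j : ℝ) + 1)) := by
    simp only [Lagrange.eval_nodal, w, sub_neg_eq_add]
  have hN0 : (Lagrange.nodal s w).eval 0 = ((r + 1).factorial : ℝ) := by
    rw [hN, ← hfact']; simp [s]
  have hW0 : Lagrange.nodalWeight s w 0 = ((r.factorial : ℝ))⁻¹ := by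
    rw [Lagrange.nodalWeight, ← hfact, ← Finset.prod_inv_distrib]
    have : s.erase 0 = (Finset.range r).map ⟨Nat.succ, Nat.succ_injective⟩ := by
      ext j
      simp only [s, Finset.mem_erase, Finset.mem_range, Finset.mem_map,
        Function.Embedding.coeFn_mk]
      constructor
      · rintro ⟨h, h'⟩
        exact ⟨j - 1, by omega, by omega⟩
      · rintro ⟨a, h, rfl⟩
        exact ⟨by omega, by omega⟩
    rw [this, Finset.prod_map]
    refine Finset.prod_congr rfl fun i _ => ?_
    simp [w]
  have hf0 : (r.factorial : ℝ) ≠ 0 := by positivity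
  have hf1 : ((r + 1).factorial : ℝ) ≠ 0 := by positivity
  have hneg : ((-1 : ℝ)) ^ r ≠ 0 := by simp
  refine ⟨fun j => ((r + 1).factorial : ℝ) / Q.eval 0 *
    (Lagrange.nodalWeight s w j * Q.eval (w j)), ?_, ?_⟩
  · have : w 0 = -1 := by simp [w]
    simp only [this, hQ0, hQ1, hW0]
    rw [Nat.factorial_succ]
    push_cast
    field_simp
  · intro k hk
    have hx : ∀ j ∈ s, (k : ℝ) ≠ w j := by
      intro j _
      have : (0 : ℝ) < (k : ℝ) + (j + 1) := by positivity
      intro h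
      simp only [w] at h
      linarith
    have hE := Lagrange.eval_interpolate_not_at_node (fun i => Q.eval (w i)) hx
    rw [← Lagrange.eq_interpolate hw hdeg] at hE
    have hsum : ∑ j ∈ Finset.range (r + 1), ((r + 1).factorial : ℝ) / Q.eval 0 *
        (Lagrange.nodalWeight s w j * Q.eval (w j)) / ((k : ℝ) + j + 1) =
        ((r + 1).factorial : ℝ) / Q.eval 0 *
          ∑ j ∈ s, Lagrange.nodalWeight s w j * ((k : ℝ) - w j)⁻¹ * Q.eval (w j) := by
      rw [Finset.mul_sum]
      refine Finset.sum_congr rfl fun j _ => ?_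
      simp only [w]
      rw [sub_neg_eq_add, ← add_assoc]
      ring
    rw [hsum]
    have hNk : (Lagrange.nodal s w).eval (k : ℝ) ≠ 0 := by
      rw [hN]; positivity
    split_ifs with h
    · subst h
      simp only [Nat.cast_zero] at hE hNk ⊢
      rw [hN0] at hE
      have hQne : Q.eval 0 ≠ 0 := by rw [hQ0]; positivity
      rw [div_mul_eq_mul_div, ← hE, div_self hQne]
    · have : Q.eval (k : ℝ) = 0 := by
        rw [hQ]
        refine Finset.prod_eq_zero (i := k - 1) (Finset.mem_range.2 (by omega)) ?_
        rw [Nat.cast_sub (by omega)]; simp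
      rw [this] at hE
      rcases mul_eq_zero.1 hE.symm with h | h
      · exact absurd h hNk
      · rw [h, mul_zero]

open Polynomial in
/-- The sharp bound for point evaluation at an endpoint of `[0, 1]` on polynomials of degree at
most `r` in terms of the `L²` norm. -/
theorem Polynomial.sq_eval_zero_le_integral {r : ℕ} {p : ℝ[X]} (hp : p.natDegree ≤ r) :
    p.eval 0 ^ 2 ≤ ((r : ℝ) + 1) ^ 2 * ∫ t in (0 : ℝ)..1, p.eval t ^ 2 := by
  obtain ⟨c, hc0, hc⟩ := exists_sum_div_eq_ite r
  let K : ℝ[X] := ∑ j ∈ Finset.range (r + 1), C (c j) * X ^ j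
  have hcoeff (k : ℕ) (hk : k ≤ r) :
      ∫ t in (0 : ℝ)..1, K.eval t * t ^ k = if k = 0 then 1 else 0 := by
    rw [← hc k hk]
    have (t : ℝ) : K.eval t * t ^ k = ∑ j ∈ Finset.range (r + 1), c j * t ^ (k + j) := by
      simp only [K, eval_finsetSum, eval_mul, eval_C, eval_pow, eval_X, Finset.sum_mul]
      refine Finset.sum_congr rfl fun j _ => by ring
    simp_rw [this]
    rw [intervalIntegral.integral_finsetSum
      fun j _ => Continuous.intervalIntegrable (by fun_prop) _ _]
    refine Finset.sum_congr rfl fun j _ => ?_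
    rw [intervalIntegral.integral_const_mul, integral_pow]
    push_cast
    simp [div_eq_mul_inv]
  have hrep (q : ℝ[X]) (hq : q.natDegree ≤ r) :
      ∫ t in (0 : ℝ)..1, K.eval t * q.eval t = q.eval 0 := by
    have (t : ℝ) : K.eval t * q.eval t =
        ∑ k ∈ Finset.range (r + 1), q.coeff k * (K.eval t * t ^ k) := by
      rw [eval_eq_sum_range' (Nat.lt_succ_of_le hq), Finset.mul_sum]
      refine Finset.sum_congr rfl fun j _ => by ring
    simp_rw [this]
    rw [intervalIntegral.integral_finsetSum
      fun j _ => Continuous.intervalIntegrable (by fun_prop) _ _]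
    rw [Finset.sum_congr rfl (g := fun k => if k = 0 then q.coeff 0 else 0)]
    · simp [coeff_zero_eq_eval_zero]
    · intro k hk
      rw [intervalIntegral.integral_const_mul, hcoeff k (by simpa [Nat.lt_succ_iff] using hk)]
      split_ifs with h <;> simp [h]
  have hKdeg : K.natDegree ≤ r := by
    refine natDegree_sum_le_of_forall_le _ _ fun j hj => (natDegree_C_mul_X_pow_le _ _).trans ?_
    simpa [Nat.lt_succ_iff] using hj
  have hK0 : K.eval 0 = ((r : ℝ) + 1) ^ 2 := by
    rw [← hc0]
    simp [K, eval_finsetSum, Finset.sum_range_succ']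
  have hR : (0 : ℝ) < ((r : ℝ) + 1) ^ 2 := by positivity
  set R : ℝ := ((r : ℝ) + 1) ^ 2
  have hsq : 0 ≤ ∫ t in (0 : ℝ)..1, (R * p.eval t - p.eval 0 * K.eval t) ^ 2 :=
    intervalIntegral.integral_nonneg zero_le_one fun t _ => sq_nonneg _
  have hexp : ∫ t in (0 : ℝ)..1, (R * p.eval t - p.eval 0 * K.eval t) ^ 2 =
      R ^ 2 * (∫ t in (0 : ℝ)..1, p.eval t ^ 2) - 2 * R * p.eval 0 * p.eval 0 +
        p.eval 0 ^ 2 * R := by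
    have (t : ℝ) : (R * p.eval t - p.eval 0 * K.eval t) ^ 2 =
        R ^ 2 * p.eval t ^ 2 - 2 * R * p.eval 0 * (K.eval t * p.eval t) +
          p.eval 0 ^ 2 * (K.eval t * K.eval t) := by ring
    simp_rw [this]
    rw [intervalIntegral.integral_add, intervalIntegral.integral_sub,
      intervalIntegral.integral_const_mul, intervalIntegral.integral_const_mul,
      intervalIntegral.integral_const_mul, hrep p hp, hrep K hKdeg, hK0] <;>
    exact Continuous.intervalIntegrable (by fun_prop) _ _
  rw [hexp] at hsq
  nlinarith [hsq, hR]

open Polynomial in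
/-- The endpoint bound with the Jacobi weight `(1 - t) ^ n`. -/
theorem Polynomial.ofReal_sq_eval_zero_le_lintegral {r : ℕ} {p : ℝ[X]} (hp : p.natDegree ≤ r)
    (n : ℕ) :
    ENNReal.ofReal (p.eval 0 ^ 2) ≤ ENNReal.ofReal (((r : ℝ) + n + 1) ^ 2) *
      ∫⁻ t in Set.Ioo (0 : ℝ) 1, ENNReal.ofReal ((1 - t) ^ n) * ENNReal.ofReal (p.eval t ^ 2) := by
  have hq : (p * (1 - X) ^ n).natDegree ≤ r + n := by
    refine natDegree_mul_le_of_le hp ?_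
    refine (natDegree_pow_le_of_le (m := 1) n ?_).trans (by simp)
    exact (natDegree_sub_le _ _).trans (by simp)
  have h := Polynomial.sq_eval_zero_le_integral hq
  simp only [eval_mul, eval_pow, eval_sub, eval_one, eval_X, sub_zero, one_pow, mul_one] at h
  refine (ENNReal.ofReal_le_ofReal h).trans ?_
  rw [ENNReal.ofReal_mul (by positivity)]
  push_cast
  gcongr
  rw [intervalIntegral.integral_of_le zero_le_one, integral_Ioc_eq_integral_Ioo,
    ofReal_integral_eq_lintegral_ofReal]
  · refine setLIntegral_mono' measurableSet_Ioo fun t ht => ?_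
    rw [← ENNReal.ofReal_mul (pow_nonneg (by linarith [ht.2]) _)]
    refine ENNReal.ofReal_le_ofReal ?_
    have h1 : (1 - t) ^ n ≤ 1 := pow_le_one₀ (by linarith [ht.2]) (by linarith [ht.1])
    have h0 : 0 ≤ (1 - t) ^ n := pow_nonneg (by linarith [ht.2]) _
    calc (p.eval t * (1 - t) ^ n) ^ 2 = (1 - t) ^ n * ((1 - t) ^ n * p.eval t ^ 2) := by ring
      _ ≤ 1 * ((1 - t) ^ n * p.eval t ^ 2) := by gcongr
      _ = _ := one_mul _
  · exact (Continuous.integrableOn_Icc (by fun_prop)).mono_set Set.Ioo_subset_Icc_self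
  · exact Filter.Eventually.of_forall fun t => sq_nonneg _

/-- The closed solid unit simplex in coordinate space. -/
def solidSimplex (n : ℕ) : Set (Fin n → ℝ) := {x | (∀ i, 0 ≤ x i) ∧ ∑ i, x i ≤ 1}

theorem isClosed_solidSimplex (n : ℕ) : IsClosed (solidSimplex n) := by
  have : solidSimplex n = (⋂ i, {x | 0 ≤ x i}) ∩ {x | ∑ i, x i ≤ 1} := by
    ext x; simp [solidSimplex]
  rw [this]
  exact (isClosed_iInter fun i => isClosed_le (by fun_prop) (by fun_prop)).inter
    (isClosed_le (by fun_prop) (by fun_prop))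

theorem isCompact_solidSimplex (n : ℕ) : IsCompact (solidSimplex n) := by
  refine (isCompact_univ_pi fun _ => isCompact_Icc (a := (0 : ℝ)) (b := 1)).of_isClosed_subset
    (isClosed_solidSimplex n) fun x hx i _ => ⟨hx.1 i, ?_⟩
  exact (Finset.single_le_sum (fun j _ => hx.1 j) (Finset.mem_univ i)).trans hx.2

theorem insertNth_mem_solidSimplex {n : ℕ} (i : Fin (n + 1)) (t : ℝ) (z : Fin n → ℝ) :
    i.insertNth (α := fun _ => ℝ) t z ∈ solidSimplex (n + 1) ↔
      0 ≤ t ∧ (∀ j, 0 ≤ z j) ∧ t + ∑ j, z j ≤ 1 := by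
  simp only [solidSimplex, Set.mem_ofPred_eq, Fin.forall_iff_succAbove i, Fin.insertNth_apply_same,
    Fin.insertNth_apply_succAbove, Fin.sum_insertNth, and_assoc]

theorem lintegral_eq_lintegral_insertNth {n : ℕ} (i : Fin (n + 1))
    {F : (Fin (n + 1) → ℝ) → ENNReal} (hF : Measurable F) :
    ∫⁻ x, F x = ∫⁻ t : ℝ, ∫⁻ z : Fin n → ℝ, F (i.insertNth (α := fun _ => ℝ) t z) := by
  have h := (volume_preserving_piFinSuccAbove (fun _ : Fin (n + 1) => ℝ) i).symm
  rw [← h.lintegral_comp hF]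
  exact lintegral_prod _ (hF.comp h.measurable).aemeasurable

theorem lintegral_eq_lintegral_smul {n : ℕ} {c : ℝ} (hc : 0 < c)
    {G : (Fin n → ℝ) → ENNReal} (hG : Measurable G) :
    ∫⁻ z, G z = ENNReal.ofReal (c ^ n) * ∫⁻ y, G (c • y) := by
  have h : ∫⁻ y, G (c • y) = ∫⁻ z, G z ∂(Measure.map (c • ·) volume) :=
    (lintegral_map hG (measurable_const_smul c)).symm
  rw [h, Measure.map_addHaar_smul _ hc.ne', lintegral_smul_measure, smul_eq_mul, ← mul_assoc,
    abs_of_pos (by positivity), ← ENNReal.ofReal_mul (by positivity)]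
  simp [hc.ne']

/-- The restriction of `f` to every affine line is a polynomial of
degree at most `r`. -/
def IsPolynomialOnLines {n : ℕ} (r : ℕ) (f : (Fin n → ℝ) → ℝ) : Prop :=
  ∀ a b : Fin n → ℝ, ∃ p : Polynomial ℝ, p.natDegree ≤ r ∧ ∀ t : ℝ, f (a + t • b) = p.eval t

theorem MvPolynomial.isPolynomialOnLines_eval {n r : ℕ} {v : MvPolynomial (Fin n) ℝ}
    (hv : v.totalDegree ≤ r) : IsPolynomialOnLines r fun x => MvPolynomial.eval x v := by
  intro a b
  refine ⟨MvPolynomial.aeval (fun i => Polynomial.C (b i) * Polynomial.X + Polynomial.C (a i)) v,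
    ?_, fun t => ?_⟩
  · simpa using MvPolynomial.aeval_natDegree_le v hv _ (n := 1)
      fun i => Polynomial.natDegree_linear_le
  · rw [← Polynomial.coe_evalRingHom, MvPolynomial.aeval_def, MvPolynomial.hom_eval₂]
    simp only [MvPolynomial.eval, MvPolynomial.coe_eval₂Hom]
    congr 1
    · ext; simp
    · ext i; simp; ring

/-- The trace inequality on a coordinate facet of the solid simplex. -/
theorem lintegral_insertNth_zero_le {n r : ℕ} {f : (Fin (n + 1) → ℝ) → ℝ} (hf : Continuous f)
    (hp : IsPolynomialOnLines r f) (i : Fin (n + 1)) :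
    ∫⁻ y in solidSimplex n, ENNReal.ofReal (f (i.insertNth (α := fun _ => ℝ) 0 y) ^ 2) ≤
      ENNReal.ofReal (((r : ℝ) + n + 1) ^ 2) *
        ∫⁻ x in solidSimplex (n + 1), ENNReal.ofReal (f x ^ 2) := by
  have hS (m : ℕ) := (isClosed_solidSimplex m).measurableSet
  have hcont : Continuous fun q : ℝ × (Fin n → ℝ) =>
      f (i.insertNth (α := fun _ => ℝ) q.1 ((1 - q.1) • q.2)) :=
    hf.comp (Continuous.finInsertNth (A := fun _ => ℝ) i continuous_fst
      (by fun_prop : Continuous fun q : ℝ × (Fin n → ℝ) => (1 - q.1) • q.2))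
  set F : (Fin (n + 1) → ℝ) → ENNReal :=
    (solidSimplex (n + 1)).indicator fun x => ENNReal.ofReal (f x ^ 2) with hFdef
  have hF : Measurable F :=
    (ENNReal.measurable_ofReal.comp (hf.pow 2).measurable).indicator (hS _)
  have hline (y : Fin n → ℝ) :
      ENNReal.ofReal (f (i.insertNth (α := fun _ => ℝ) 0 y) ^ 2) ≤
        ENNReal.ofReal (((r : ℝ) + n + 1) ^ 2) *
          ∫⁻ t in Set.Ioo (0 : ℝ) 1, ENNReal.ofReal ((1 - t) ^ n) *
            ENNReal.ofReal (f (i.insertNth (α := fun _ => ℝ) t ((1 - t) • y)) ^ 2) := by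
    obtain ⟨p, hpr, hpe⟩ := hp (i.insertNth (α := fun _ => ℝ) 0 y)
      (i.insertNth (α := fun _ => ℝ) 1 (-y))
    have hpt (t : ℝ) : f (i.insertNth (α := fun _ => ℝ) t ((1 - t) • y)) = p.eval t := by
      rw [← hpe]
      congr 1
      ext j
      refine i.succAboveCases ?_ (fun k => ?_) j <;> simp
      ring
    have h0 : f (i.insertNth (α := fun _ => ℝ) 0 y) = p.eval 0 := by
      simpa using hpt 0
    simp_rw [h0, hpt]
    exact Polynomial.ofReal_sq_eval_zero_le_lintegral hpr n
  have hmeas : Measurable fun q : ℝ × (Fin n → ℝ) => ENNReal.ofReal ((1 - q.1) ^ n) *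
      ENNReal.ofReal (f (i.insertNth (α := fun _ => ℝ) q.1 ((1 - q.1) • q.2)) ^ 2) :=
    (ENNReal.measurable_ofReal.comp (by fun_prop)).mul
      (ENNReal.measurable_ofReal.comp (hcont.pow 2).measurable)
  calc ∫⁻ y in solidSimplex n, ENNReal.ofReal (f (i.insertNth (α := fun _ => ℝ) 0 y) ^ 2)
      ≤ ∫⁻ y in solidSimplex n, ENNReal.ofReal (((r : ℝ) + n + 1) ^ 2) *
          ∫⁻ t in Set.Ioo (0 : ℝ) 1, ENNReal.ofReal ((1 - t) ^ n) *
            ENNReal.ofReal (f (i.insertNth (α := fun _ => ℝ) t ((1 - t) • y)) ^ 2) :=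
        lintegral_mono hline
    _ = ENNReal.ofReal (((r : ℝ) + n + 1) ^ 2) *
          ∫⁻ t in Set.Ioo (0 : ℝ) 1, ∫⁻ y in solidSimplex n, ENNReal.ofReal ((1 - t) ^ n) *
            ENNReal.ofReal (f (i.insertNth (α := fun _ => ℝ) t ((1 - t) • y)) ^ 2) := by
        rw [lintegral_const_mul' _ _ ENNReal.ofReal_ne_top,
          lintegral_lintegral_swap (f := fun y t => ENNReal.ofReal ((1 - t) ^ n) *
            ENNReal.ofReal (f (i.insertNth (α := fun _ => ℝ) t ((1 - t) • y)) ^ 2)) (hmeas.comp measurable_swap).aemeasurable]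
    _ ≤ _ := by
        gcongr
        rw [← lintegral_indicator (hS _), lintegral_eq_lintegral_insertNth i hF]
        refine le_trans ?_ (setLIntegral_le_lintegral (Set.Ioo (0 : ℝ) 1) _)
        refine setLIntegral_mono' measurableSet_Ioo fun t ht => ?_
        have ht1 : 0 < 1 - t := by linarith [ht.2]
        have hG : Measurable fun z : Fin n → ℝ => F (i.insertNth (α := fun _ => ℝ) t z) :=
          hF.comp (continuous_const.finInsertNth i continuous_id).measurable
        rw [lintegral_eq_lintegral_smul ht1 hG,
          lintegral_const_mul' _ _ ENNReal.ofReal_ne_top, ← lintegral_indicator (hS _)]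
        gcongr with y
        by_cases hy : y ∈ solidSimplex n
        swap
        · simp [hy]
        rw [Set.indicator_of_mem hy]
        rw [hFdef, Set.indicator_of_mem]
        rw [insertNth_mem_solidSimplex]
        refine ⟨ht.1.le, fun j => mul_nonneg ht1.le (hy.1 j), ?_⟩
        simp only [Pi.smul_apply, smul_eq_mul, ← Finset.mul_sum]
        nlinarith [hy.2]

/-- The affine involution of the solid simplex exchanging the vertices `0` and `e₀`. -/
def simplexSwap {n : ℕ} (x : Fin (n + 1) → ℝ) : Fin (n + 1) → ℝ :=
  Function.update x 0 (1 - ∑ i, x i)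

theorem simplexSwap_insertNth {n : ℕ} (t : ℝ) (z : Fin n → ℝ) :
    simplexSwap (Fin.insertNth (α := fun _ => ℝ) 0 t z) =
      Fin.insertNth (α := fun _ => ℝ) 0 (1 - ∑ j, z j - t) z := by
  ext j
  refine Fin.succAboveCases 0 ?_ (fun k => ?_) j
  · simp [simplexSwap, Fin.sum_univ_succ]; ring
  · simp [simplexSwap]

theorem continuous_simplexSwap (n : ℕ) : Continuous (simplexSwap (n := n)) :=
  continuous_id.update 0 (by fun_prop)

theorem IsPolynomialOnLines.comp_simplexSwap {n r : ℕ} {f : (Fin (n + 1) → ℝ) → ℝ}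
    (hp : IsPolynomialOnLines r f) : IsPolynomialOnLines r (f ∘ simplexSwap) := by
  intro a b
  obtain ⟨p, hpr, hpe⟩ := hp (simplexSwap a) (Function.update b 0 (-∑ i, b i))
  refine ⟨p, hpr, fun t => ?_⟩
  rw [← hpe, Function.comp_apply]
  congr 1
  ext j
  rcases eq_or_ne j 0 with rfl | hj
  · simp [simplexSwap, Finset.sum_add_distrib, Finset.mul_sum]; ring
  · simp [simplexSwap, hj]

theorem lintegral_comp_simplexSwap {n : ℕ} {F : (Fin (n + 1) → ℝ) → ENNReal} (hF : Measurable F) :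
    ∫⁻ x in solidSimplex (n + 1), F (simplexSwap x) = ∫⁻ x in solidSimplex (n + 1), F x := by
  have hS := (isClosed_solidSimplex (n + 1)).measurableSet
  have hswap (G : (Fin (n + 1) → ℝ) → ENNReal) (hG : Measurable G) :
      ∫⁻ x, G (simplexSwap x) = ∫⁻ x, G x := by
    have hins : Measurable fun q : ℝ × (Fin n → ℝ) =>
        Fin.insertNth (α := fun _ => ℝ) 0 q.1 q.2 :=
      (continuous_fst.finInsertNth 0 continuous_snd).measurable
    rw [lintegral_eq_lintegral_insertNth 0 hG,
      lintegral_eq_lintegral_insertNth 0 (F := fun x => G (simplexSwap x))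
        (hG.comp (continuous_simplexSwap n).measurable),
      lintegral_lintegral_swap
        (f := fun t z => G (Fin.insertNth (α := fun _ => ℝ) 0 t z)) (hG.comp hins).aemeasurable,
      lintegral_lintegral_swap
        (f := fun t z => G (simplexSwap (Fin.insertNth (α := fun _ => ℝ) 0 t z)))
        ((hG.comp (continuous_simplexSwap n).measurable).comp hins).aemeasurable]
    refine lintegral_congr fun z => ?_
    simp_rw [simplexSwap_insertNth]
    exact lintegral_sub_left_eq_self
      (fun t => G (Fin.insertNth (α := fun _ => ℝ) 0 t z)) (1 - ∑ j, z j)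
  have hmem (x : Fin (n + 1) → ℝ) :
      simplexSwap x ∈ solidSimplex (n + 1) ↔ x ∈ solidSimplex (n + 1) := by
    obtain ⟨t, z, rfl⟩ : ∃ t z, Fin.insertNth (α := fun _ => ℝ) 0 t z = x :=
      ⟨x 0, fun j => x j.succ, by
        ext j; refine Fin.succAboveCases 0 ?_ (fun k => ?_) j <;> simp⟩
    rw [simplexSwap_insertNth, insertNth_mem_solidSimplex, insertNth_mem_solidSimplex]
    constructor <;> rintro ⟨h1, h2, h3⟩ <;> exact ⟨by linarith, h2, by linarith⟩
  rw [← lintegral_indicator hS, ← lintegral_indicator hS, ← hswap _ (hF.indicator hS)]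
  refine lintegral_congr fun x => ?_
  by_cases hx : x ∈ solidSimplex (n + 1)
  · rw [Set.indicator_of_mem hx, Set.indicator_of_mem ((hmem x).2 hx)]
  · rw [Set.indicator_of_notMem hx, Set.indicator_of_notMem (mt (hmem x).1 hx)]

/-- Integration over a Lipschitz-parametrized set with respect to Hausdorff measure. -/
theorem setLIntegral_hausdorffMeasure_image_le {n : ℕ} {X : Type*} [EMetricSpace X]
    [MeasurableSpace X] [BorelSpace X] {K : NNReal} {φ : (Fin n → ℝ) → X}
    (hφ : LipschitzWith K φ) {T : Set (Fin n → ℝ)} {g : X → ENNReal} (hg : Measurable g) :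
    ∫⁻ x in φ '' T, g x ∂μH[n] ≤ (K : ENNReal) ^ n * ∫⁻ y in T, g (φ y) := by
  have hm := hφ.continuous.measurable
  have hle : (μH[n] : Measure X).restrict (φ '' T) ≤
      (K : ENNReal) ^ n • Measure.map φ (volume.restrict T) := by
    refine Measure.le_iff.2 fun A hA => ?_
    rw [Measure.restrict_apply hA, Measure.smul_apply, Measure.map_apply hm hA,
      Measure.restrict_apply (hm hA), smul_eq_mul, ← Set.image_preimage_inter]
    refine (hφ.hausdorffMeasure_image_le (Nat.cast_nonneg n) _).trans ?_
    have hv : (μH[n] : Measure (Fin n → ℝ)) = volume := by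
      simpa using hausdorffMeasure_pi_real (ι := Fin n)
    rw [hv, ENNReal.rpow_natCast, Set.inter_comm]
  refine (lintegral_mono' hle le_rfl).trans ?_
  rw [lintegral_smul_measure, lintegral_map hg hm, smul_eq_mul]

theorem lipschitzWith_toLp_insertNth_zero {n : ℕ} (i : Fin (n + 1)) :
    ∃ K, LipschitzWith K fun y : Fin n → ℝ =>
      (WithLp.toLp 2 (i.insertNth (α := fun _ => ℝ) 0 y) : EuclideanSpace ℝ (Fin (n + 1))) := by
  have h : LipschitzWith 1 fun y : Fin n → ℝ => i.insertNth (α := fun _ => ℝ) 0 y :=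
    LipschitzWith.of_dist_le_mul fun x y => by simp [Fin.dist_insertNth_insertNth]
  exact ⟨_, (PiLp.lipschitzWith_toLp 2 (fun _ : Fin (n + 1) => ℝ)).comp h⟩

theorem lipschitzWith_toLp_insertNth_one_sub_sum (n : ℕ) :
    ∃ K, LipschitzWith K fun y : Fin n → ℝ =>
      (WithLp.toLp 2 (Fin.insertNth (α := fun _ => ℝ) 0 (1 - ∑ j, y j) y) :
        EuclideanSpace ℝ (Fin (n + 1))) := by
  have h : LipschitzWith (n + 1) fun y : Fin n → ℝ =>
      Fin.insertNth (α := fun _ => ℝ) 0 (1 - ∑ j, y j) y := by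
    refine LipschitzWith.of_dist_le_mul fun x y => ?_
    rw [Fin.dist_insertNth_insertNth, max_le_iff]
    push_cast
    refine ⟨?_, ?_⟩
    · rw [dist_sub_left]
      refine (dist_sum_sum_le_of_le _ fun j _ => dist_le_pi_dist x y j).trans ?_
      simp
      nlinarith [dist_nonneg (x := x) (y := y)]
    · nlinarith [dist_nonneg (x := x) (y := y), n.cast_nonneg (α := ℝ)]
  exact ⟨_, (PiLp.lipschitzWith_toLp 2 (fun _ : Fin (n + 1) => ℝ)).comp h⟩

theorem frontier_simplex_subset (n : ℕ) :
    frontier {x : EuclideanSpace ℝ (Fin (n + 1)) | (∀ i, 0 ≤ x i) ∧ ∑ i, x i ≤ 1} ⊆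
      (⋃ i : Fin (n + 1), (fun y : Fin n → ℝ =>
        (WithLp.toLp 2 (i.insertNth (α := fun _ => ℝ) 0 y) : EuclideanSpace ℝ (Fin (n + 1)))) ''
          solidSimplex n) ∪
      (fun y : Fin n → ℝ => (WithLp.toLp 2 (Fin.insertNth (α := fun _ => ℝ) 0 (1 - ∑ j, y j) y) :
        EuclideanSpace ℝ (Fin (n + 1)))) '' solidSimplex n := by
  have hclosed : IsClosed
      {x : EuclideanSpace ℝ (Fin (n + 1)) | (∀ i, 0 ≤ x i) ∧ ∑ i, x i ≤ 1} :=
    (isClosed_solidSimplex (n + 1)).preimage (PiLp.continuous_ofLp 2 _)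
  have hopen : IsOpen {x : EuclideanSpace ℝ (Fin (n + 1)) | (∀ i, 0 < x i) ∧ ∑ i, x i < 1} := by
    have : {x : EuclideanSpace ℝ (Fin (n + 1)) | (∀ i, 0 < x i) ∧ ∑ i, x i < 1} =
        (⋂ i, {x | 0 < x i}) ∩ {x | ∑ i, x i < 1} := by
      ext x; simp
    rw [this]
    exact (isOpen_iInter_of_finite fun i => isOpen_lt (by fun_prop) (by fun_prop)).inter
      (isOpen_lt (by fun_prop) (by fun_prop))
  have hsub : {x : EuclideanSpace ℝ (Fin (n + 1)) | (∀ i, 0 < x i) ∧ ∑ i, x i < 1} ⊆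
      {x | (∀ i, 0 ≤ x i) ∧ ∑ i, x i ≤ 1} := fun y hy => ⟨fun i => (hy.1 i).le, hy.2.le⟩
  intro x hx
  rw [hclosed.frontier_eq] at hx
  obtain ⟨⟨hx0, hx1⟩, hxi⟩ := hx
  have hni : ¬ ((∀ i, 0 < x i) ∧ ∑ i, x i < 1) := fun h =>
    hxi (interior_maximal hsub hopen h)
  have hmem (i : Fin (n + 1)) : (fun j => x (i.succAbove j)) ∈ solidSimplex n := by
    refine ⟨fun j => hx0 _, ?_⟩
    rw [Fin.sum_univ_succAbove _ i] at hx1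
    linarith [hx0 i]
  by_cases h : ∀ i, 0 < x i
  · right
    have hs : ∑ i, x i = 1 := le_antisymm hx1 (not_lt.1 fun h' => hni ⟨h, h'⟩)
    refine ⟨_, hmem 0, ?_⟩
    ext j
    refine Fin.succAboveCases 0 ?_ (fun k => ?_) j
    · rw [Fin.sum_univ_succAbove _ 0] at hs
      simp only [Fin.insertNth_apply_same]
      linarith
    · simp
  · left
    push Not at h
    obtain ⟨i, hi⟩ := h
    refine Set.mem_iUnion.2 ⟨i, _, hmem i, ?_⟩
    ext j
    refine Fin.succAboveCases i ?_ (fun k => ?_) j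
    · simp only [Fin.insertNth_apply_same]
      exact le_antisymm (hx0 i) hi
    · simp

theorem exists_lintegral_frontier_simplex_le (n : ℕ) :
    ∃ L : NNReal, ∀ (r : ℕ) (f : (Fin (n + 1) → ℝ) → ℝ), Continuous f → IsPolynomialOnLines r f →
      ∫⁻ x in frontier {x : EuclideanSpace ℝ (Fin (n + 1)) | (∀ i, 0 ≤ x i) ∧ ∑ i, x i ≤ 1},
          ENNReal.ofReal (f x ^ 2) ∂μH[n] ≤
        L * (ENNReal.ofReal (((r : ℝ) + n + 1) ^ 2) *
          ∫⁻ x in solidSimplex (n + 1), ENNReal.ofReal (f x ^ 2)) := by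
  choose K hK using lipschitzWith_toLp_insertNth_zero (n := n)
  obtain ⟨K', hK'⟩ := lipschitzWith_toLp_insertNth_one_sub_sum n
  refine ⟨∑ i, K i ^ n + K' ^ n, fun r f hf hp => ?_⟩
  have hg : Measurable fun x : EuclideanSpace ℝ (Fin (n + 1)) => ENNReal.ofReal (f x ^ 2) :=
    ENNReal.measurable_ofReal.comp ((hf.comp (PiLp.continuous_ofLp 2 _)).pow 2).measurable
  refine (lintegral_mono_set (frontier_simplex_subset n)).trans ?_
  refine (lintegral_union_le _ _ _).trans ?_
  push_cast
  rw [add_mul, Finset.sum_mul]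
  gcongr
  · refine (lintegral_iUnion_le _ _).trans ?_
    rw [tsum_fintype]
    gcongr with i
    refine (setLIntegral_hausdorffMeasure_image_le (hK i) hg).trans ?_
    gcongr
    exact lintegral_insertNth_zero_le hf hp i
  · refine (setLIntegral_hausdorffMeasure_image_le hK' hg).trans ?_
    gcongr
    have h := lintegral_insertNth_zero_le (hf.comp (continuous_simplexSwap n))
      hp.comp_simplexSwap 0
    simp only [Function.comp_apply] at h
    rw [lintegral_comp_simplexSwap (F := fun x => ENNReal.ofReal (f x ^ 2))
      (ENNReal.measurable_ofReal.comp (hf.pow 2).measurable)] at h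
    simpa only [simplexSwap_insertNth, sub_zero] using h

/-- **Polynomial trace inverse inequality** (reference-element form of Lemma 3.2).
For every dimension `d ≥ 1` there is `C > 0` depending only on `d` such that for every
`r ≥ 1` and every real polynomial `v` in `d` variables of total degree at most `r`,
`∫_{∂Δ_d} v² dH^{d−1} ≤ C r² ∫_{Δ_d} v² dx`, where `Δ_d` is the standard unit simplex
in Euclidean `ℝᵈ`, `∂Δ_d` its topological boundary, `H^{d−1}` the `(d−1)`-dimensional
Hausdorff measure, and `dx` the Lebesgue measure. -/
theorem polynomial_trace_inverse_inequality (d : ℕ) (hd : 1 ≤ d) :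
    ∃ C : ℝ, 0 < C ∧
      ∀ r : ℕ, 1 ≤ r → ∀ v : MvPolynomial (Fin d) ℝ, v.totalDegree ≤ r →
        (∫ x in frontier {x : EuclideanSpace ℝ (Fin d) |
              (∀ i, 0 ≤ x i) ∧ ∑ i, x i ≤ 1},
            (MvPolynomial.eval (fun i => x i) v) ^ 2 ∂(μH[(d : ℝ) - 1])) ≤
          C * (r : ℝ) ^ 2 *
            ∫ x in {x : EuclideanSpace ℝ (Fin d) | (∀ i, 0 ≤ x i) ∧ ∑ i, x i ≤ 1},
              (MvPolynomial.eval (fun i => x i) v) ^ 2 := by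
  obtain ⟨n, rfl⟩ : ∃ n, d = n + 1 := ⟨d - 1, by omega⟩
  obtain ⟨L, hL⟩ := exists_lintegral_frontier_simplex_le n
  refine ⟨(L + 1) * ((n : ℝ) + 2) ^ 2, by positivity, fun r hr v hv => ?_⟩
  have hf : Continuous fun x : Fin (n + 1) → ℝ => MvPolynomial.eval x v :=
    MvPolynomial.continuous_eval v
  have hfE : Continuous fun x : EuclideanSpace ℝ (Fin (n + 1)) =>
      MvPolynomial.eval (fun i => x i) v ^ 2 := (hf.comp (PiLp.continuous_ofLp 2 _)).pow 2
  have hvol : ∫ x in {x : EuclideanSpace ℝ (Fin (n + 1)) | (∀ i, 0 ≤ x i) ∧ ∑ i, x i ≤ 1},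
      (MvPolynomial.eval (fun i => x i) v) ^ 2 =
        ∫ x in solidSimplex (n + 1), (MvPolynomial.eval x v) ^ 2 :=
    (PiLp.volume_preserving_ofLp (Fin (n + 1))).setIntegral_preimage_emb
      (MeasurableEquiv.toLp 2 (Fin (n + 1) → ℝ)).symm.measurableEmbedding
      (fun x => MvPolynomial.eval x v ^ 2) (solidSimplex (n + 1))
  have hint : IntegrableOn (fun x => MvPolynomial.eval x v ^ 2) (solidSimplex (n + 1)) :=
    (hf.pow 2).continuousOn.integrableOn_compact (isCompact_solidSimplex _)
  have hcast : ((n + 1 : ℕ) : ℝ) - 1 = n := by push_cast; ring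
  have hI : 0 ≤ ∫ x in solidSimplex (n + 1), (MvPolynomial.eval x v) ^ 2 :=
    integral_nonneg fun x => sq_nonneg _
  rw [hvol, hcast, integral_eq_lintegral_of_nonneg_ae
    (Filter.Eventually.of_forall fun x => sq_nonneg _) hfE.aestronglyMeasurable]
  have h := hL r _ hf (MvPolynomial.isPolynomialOnLines_eval hv)
  rw [← ofReal_integral_eq_lintegral_ofReal hint
    (Filter.Eventually.of_forall fun x => sq_nonneg _)] at h
  refine (ENNReal.toReal_mono (by finiteness) h).trans ?_
  rw [ENNReal.toReal_mul, ENNReal.toReal_mul, ENNReal.toReal_ofReal (by positivity),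
    ENNReal.toReal_ofReal hI, ENNReal.coe_toReal, ← mul_assoc]
  have hr' : (1 : ℝ) ≤ r := by exact_mod_cast hr
  have hrn : (r : ℝ) + n + 1 ≤ (n + 2) * r := by nlinarith [n.cast_nonneg (α := ℝ)]
  calc (L : ℝ) * ((r : ℝ) + n + 1) ^ 2 * _ ≤ (L + 1) * ((n + 2) * r) ^ 2 * _ := by
        gcongr
        linarith
    _ = _ := by ring
end

section
/- H¹–L² polynomial inverse inequality (reference-element form of Lemma 4.2): For every dimension d ≥ 1 there exists a constant C > 0, depending only on d, such that for every integer ℓ ≥ 1 and every real polynomial v in d variables of total degree at most ℓ, ∫_{Δ_d} ‖∇v(x)‖² dx ≤ C ℓ⁴ ∫_{Δ_d} v(x)² dx, where Δ_d = { x ∈ ℝᵈ : xᵢ ≥ 0 for all i, and x₁ + ⋯ + x_d ≤ 1 } is the standard unit simplex, ∇v is the gradient of v, ‖·‖ is the Euclidean norm on ℝᵈ, and dx is the Lebesgue measure. -/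
open MeasureTheory

namespace Polynomial

/-- Integration over the unit interval, as a linear functional on real polynomials. -/
noncomputable def unitIntegral : ℝ[X] →ₗ[ℝ] ℝ where
  toFun p := ∫ x in (0 : ℝ)..1, p.eval x
  map_add' p q := by
    simp only [eval_add]
    exact intervalIntegral.integral_add (p.continuous.intervalIntegrable _ _)
      (q.continuous.intervalIntegrable _ _)
  map_smul' c p := by simp

theorem unitIntegral_apply (p : ℝ[X]) : unitIntegral p = ∫ x in (0 : ℝ)..1, p.eval x := rfl

theorem unitIntegral_derivative (p : ℝ[X]) :
    unitIntegral (derivative p) = p.eval 1 - p.eval 0 :=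
  intervalIntegral.integral_eq_sub_of_hasDerivAt (fun x _ ↦ p.hasDerivAt x)
    ((derivative p).continuous.intervalIntegrable _ _)

theorem unitIntegral_mul_derivative (p q : ℝ[X]) :
    unitIntegral (p * derivative q) =
      p.eval 1 * q.eval 1 - p.eval 0 * q.eval 0 - unitIntegral (derivative p * q) := by
  have h := unitIntegral_derivative (p * q)
  rw [derivative_mul, map_add, eval_mul, eval_mul] at h
  linarith

theorem unitIntegral_sq_nonneg (p : ℝ[X]) : 0 ≤ unitIntegral (p ^ 2) :=
  intervalIntegral.integral_nonneg zero_le_one fun x _ ↦ by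
    rw [eval_pow]; positivity

theorem unitIntegral_C_mul (c : ℝ) (p : ℝ[X]) :
    unitIntegral (C c * p) = c * unitIntegral p := by
  rw [← smul_eq_C_mul, map_smul, smul_eq_mul]

theorem unitIntegral_mul_iterate_derivative {n : ℕ} {g : ℝ[X]}
    (h₀ : ∀ j < n, (derivative^[j] g).eval 0 = 0) (h₁ : ∀ j < n, (derivative^[j] g).eval 1 = 0)
    (q : ℝ[X]) :
    unitIntegral (q * derivative^[n] g) = (-1) ^ n * unitIntegral (derivative^[n] q * g) := by
  induction n generalizing q with
  | zero => simp
  | succ n ih =>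
    rw [Function.iterate_succ_apply', unitIntegral_mul_derivative, h₀ n n.lt_succ_self,
      h₁ n n.lt_succ_self,
      ih (fun j hj ↦ h₀ j (hj.trans n.lt_succ_self)) (fun j hj ↦ h₁ j (hj.trans n.lt_succ_self)),
      Function.iterate_succ_apply]
    ring

/-- The shifted Legendre polynomial with real coefficients. -/
noncomputable def realLegendre (n : ℕ) : ℝ[X] := (shiftedLegendre n).map (Int.castRingHom ℝ)

theorem natDegree_realLegendre (n : ℕ) : (realLegendre n).natDegree = n := by
  rw [realLegendre, natDegree_map_eq_of_injective (RingHom.injective_int _),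
    natDegree_shiftedLegendre]

theorem factorial_mul_realLegendre (n : ℕ) :
    (n.factorial : ℝ[X]) * realLegendre n = derivative^[n] (X ^ n * (1 - X) ^ n) := by
  have h := congrArg (map (Int.castRingHom ℝ)) (factorial_mul_shiftedLegendre_eq n)
  simpa [realLegendre, ← iterate_derivative_map] using h

theorem unitIntegral_mul_realLegendre {n : ℕ} {q : ℝ[X]} (hq : q.natDegree < n) :
    unitIntegral (q * realLegendre n) = 0 := by
  have key : unitIntegral (q * derivative^[n] (X ^ n * (1 - X) ^ n)) = 0 := by
    have vanish : ∀ a r : ℝ[X], ∀ c : ℝ, a.eval c = 0 → a ^ n ∣ r →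
        ∀ j < n, (derivative^[j] r).eval c = 0 := by
      intro a r c ha hr j hj
      obtain ⟨s, hs⟩ := pow_sub_dvd_iterate_derivative_of_pow_dvd j hr
      rw [hs, eval_mul, eval_pow, ha, zero_pow (Nat.sub_ne_zero_of_lt hj), zero_mul]
    rw [unitIntegral_mul_iterate_derivative (vanish X _ 0 (by simp) (dvd_mul_right _ _))
      (vanish (1 - X) _ 1 (by simp) (dvd_mul_left _ _)), iterate_derivative_eq_zero hq]
    simp
  rw [← factorial_mul_realLegendre, mul_left_comm, ← C_eq_natCast, unitIntegral_C_mul] at key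
  exact (mul_eq_zero.1 key).resolve_left (by positivity)

theorem realLegendre_eval_zero (n : ℕ) : (realLegendre n).eval 0 = 1 := by
  rw [← coeff_zero_eq_eval_zero, realLegendre, coeff_map, coeff_shiftedLegendre]
  simp

theorem realLegendre_comp (n : ℕ) :
    (-1) ^ n * (realLegendre n).comp (1 - X) = realLegendre n := by
  have h := congrArg (map (Int.castRingHom ℝ)) (neg_one_pow_mul_shiftedLegendre_comp_one_sub_X_eq n)
  simpa [realLegendre, map_comp] using h

theorem realLegendre_eval_one (n : ℕ) : (realLegendre n).eval 1 = (-1) ^ n := by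
  conv_lhs => rw [← realLegendre_comp]
  simp [realLegendre_eval_zero]

theorem derivative_realLegendre_eval_zero (n : ℕ) :
    (derivative (realLegendre n)).eval 0 = -(n * (n + 1)) := by
  rw [← coeff_zero_eq_eval_zero, coeff_derivative, realLegendre, coeff_map, coeff_shiftedLegendre]
  simp

theorem derivative_realLegendre_eval_one (n : ℕ) :
    (derivative (realLegendre n)).eval 1 = (-1) ^ n * (n * (n + 1)) := by
  conv_lhs => rw [← realLegendre_comp]
  have : ((-1 : ℝ[X]) ^ n) = C ((-1) ^ n) := by simp
  rw [this, derivative_C_mul]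
  simp [derivative_comp, derivative_realLegendre_eval_zero]

theorem unitIntegral_derivative_realLegendre_sq (n : ℕ) :
    unitIntegral (derivative (realLegendre n) ^ 2) = 2 * n * (n + 1) := by
  have h : unitIntegral (derivative (derivative (realLegendre n)) * realLegendre n) = 0 := by
    rcases Nat.eq_zero_or_pos n with rfl | hn
    · rw [eq_C_of_natDegree_eq_zero (natDegree_realLegendre 0)]; simp
    · apply unitIntegral_mul_realLegendre
      have h₁ := natDegree_derivative_le (realLegendre n)
      have h₂ := natDegree_derivative_le (derivative (realLegendre n))
      rw [natDegree_realLegendre] at h₁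
      omega
  rw [sq, unitIntegral_mul_derivative, h, realLegendre_eval_one, realLegendre_eval_zero,
    derivative_realLegendre_eval_one, derivative_realLegendre_eval_zero]
  have : ((-1 : ℝ) ^ n) * (-1) ^ n = 1 := by rw [← mul_pow]; simp
  linear_combination (n * (n + 1) : ℝ) * this

theorem unitIntegral_realLegendre_sq (n : ℕ) :
    (2 * n + 1) * unitIntegral (realLegendre n ^ 2) = 1 := by
  set P := realLegendre n with hP
  have hlow : unitIntegral ((X * derivative P - C (n : ℝ) * P) * P) = 0 := by
    rcases Nat.eq_zero_or_pos n with hn | hn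
    · have : P = C (P.coeff 0) := eq_C_of_natDegree_eq_zero (by rw [natDegree_realLegendre, hn])
      rw [this, hn]; simp
    · apply unitIntegral_mul_realLegendre
      refine Nat.lt_of_le_pred hn (natDegree_le_iff_coeff_eq_zero.2 fun m hm ↦ ?_)
      replace hm : n ≤ m := Nat.le_of_pred_lt hm
      obtain ⟨m, rfl⟩ := Nat.exists_eq_add_of_le' (hn.trans_le hm)
      rw [coeff_sub, coeff_X_mul, coeff_derivative, coeff_C_mul]
      rcases hm.eq_or_lt with h | h
      · rw [h]; push_cast; ring
      · rw [coeff_eq_zero_of_natDegree_lt (by rwa [natDegree_realLegendre])]; simp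
  have hder := unitIntegral_derivative (X * P ^ 2)
  have e : derivative (X * P ^ 2) =
      C (2 * n + 1 : ℝ) * P ^ 2 + C 2 * ((X * derivative P - C (n : ℝ) * P) * P) := by
    simp only [derivative_mul, derivative_X, derivative_pow, C_add, C_mul, C_1]
    norm_num
    ring
  rw [e, map_add, unitIntegral_C_mul, unitIntegral_C_mul, hlow] at hder
  have : (((-1 : ℝ) ^ n)) ^ 2 = 1 := by rw [← pow_mul, mul_comm, pow_mul]; simp
  simpa [hP, realLegendre_eval_one, this] using hder

/-- Markov's inequality in `L²(0, 1)`. -/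
theorem unitIntegral_derivative_sq_le {n : ℕ} {p : ℝ[X]} (hp : p.natDegree ≤ n) :
    unitIntegral (derivative p ^ 2) ≤ (n + 1) ^ 4 * unitIntegral (p ^ 2) := by
  induction n generalizing p with
  | zero =>
    rw [eq_C_of_natDegree_le_zero hp]
    simpa using unitIntegral_sq_nonneg (C (p.coeff 0))
  | succ n ih =>
    set P := realLegendre (n + 1) with hP
    have hdeg : P.natDegree = n + 1 := natDegree_realLegendre _
    have hlead : P.coeff (n + 1) ≠ 0 := by
      rw [← hdeg, coeff_natDegree, Ne, leadingCoeff_eq_zero]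
      rintro h
      simp [h] at hdeg
    obtain ⟨a, q, hq, rfl⟩ : ∃ (a : ℝ) (q : ℝ[X]), q.natDegree ≤ n ∧ p = q + C a * P := by
      refine ⟨p.coeff (n + 1) / P.coeff (n + 1),
        p - C (p.coeff (n + 1) / P.coeff (n + 1)) * P, ?_, by ring⟩
      rw [natDegree_le_iff_coeff_eq_zero]
      intro m hm
      rw [coeff_sub, coeff_C_mul]
      rcases (Nat.succ_le_of_lt hm).eq_or_lt with h | h
      · rw [← h]; field_simp; ring
      · rw [coeff_eq_zero_of_natDegree_lt (hp.trans_lt h),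
          coeff_eq_zero_of_natDegree_lt (hdeg.trans_lt h)]; simp
    have horth : unitIntegral (q * P) = 0 := unitIntegral_mul_realLegendre (by omega)
    have hN := unitIntegral_realLegendre_sq (n + 1)
    have hD := unitIntegral_derivative_realLegendre_sq (n + 1)
    have hQ := ih hq
    rw [← hP] at hN hD
    have e₁ : (q + C a * P) ^ 2 = q ^ 2 + C (2 * a) * (q * P) + C (a ^ 2) * P ^ 2 := by
      simp only [C_mul, C_pow, map_ofNat]; ring
    have e₂ : ∀ s t : ℝ, (C s * derivative q + C t * derivative P) ^ 2 =
        C (s ^ 2) * derivative q ^ 2 + C (2 * s * t) * (derivative q * derivative P) +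
          C (t ^ 2) * derivative P ^ 2 := by
      intro s t; simp only [C_mul, C_pow, map_ofNat]; ring
    have hsq : ∀ s t : ℝ, unitIntegral ((C s * derivative q + C t * derivative P) ^ 2) =
        s ^ 2 * unitIntegral (derivative q ^ 2) +
          2 * s * t * unitIntegral (derivative q * derivative P) +
          t ^ 2 * unitIntegral (derivative P ^ 2) := by
      intro s t; rw [e₂]; simp only [map_add, unitIntegral_C_mul]
    have e₃ : derivative (q + C a * P) = C 1 * derivative q + C a * derivative P := by
      simp
    rw [e₃, hsq, e₁]
    simp only [map_add, unitIntegral_C_mul, horth]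
    have hm : (0 : ℝ) < (n : ℝ) + 1 := by positivity
    push_cast at *
    set m : ℝ := (n : ℝ) + 1 with hmdef
    set Q := unitIntegral (q ^ 2)
    set N := unitIntegral (P ^ 2)
    set U := unitIntegral (derivative q ^ 2)
    set W := unitIntegral (derivative q * derivative P)
    set D := 2 * m * (m + 1) * (2 * m + 1) with hDdef
    have hDpos : 0 < D := by positivity
    have hN0 : 0 < N := by
      by_contra! h
      nlinarith
    have hV : unitIntegral (derivative P ^ 2) = D * N := by
      rw [hD]; linear_combination (-(2 * m * (m + 1))) * hN
    rw [hV]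
    have hpos := unitIntegral_sq_nonneg (C D * derivative q + C (-(m ^ 4 * a)) * derivative P)
    rw [hsq, hV] at hpos
    have hcross : 2 * a * W ≤ D * Q + m ^ 4 * a ^ 2 * N := by
      have hm4 : 0 < D * m ^ 4 := by positivity
      have := mul_le_mul_of_nonneg_left hQ (sq_nonneg D)
      refine le_of_mul_le_mul_left ?_ hm4
      nlinarith
    have hQ0 : 0 ≤ Q := unitIntegral_sq_nonneg q
    have hB : m ^ 4 + D ≤ (m + 1) ^ 4 := by rw [hDdef]; nlinarith
    have hfin := mul_le_mul_of_nonneg_right hB (by positivity : 0 ≤ Q + a ^ 2 * N)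
    nlinarith

/-- Markov's inequality in `L²(0, L)`. -/
theorem integral_derivative_sq_le {n : ℕ} (hn : 1 ≤ n) {p : ℝ[X]} (hp : p.natDegree ≤ n)
    {L : ℝ} (hL : 0 ≤ L) :
    L ^ 2 * ∫ t in (0 : ℝ)..L, (derivative p).eval t ^ 2 ≤
      16 * n ^ 4 * ∫ t in (0 : ℝ)..L, p.eval t ^ 2 := by
  rcases hL.eq_or_lt with rfl | hL
  · simp
  have hdeg : (p.comp (C L * X)).natDegree ≤ n := by
    refine natDegree_comp_le.trans ?_
    calc _ ≤ p.natDegree * 1 := by gcongr; exact (natDegree_C_mul_le L X).trans natDegree_X_le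
      _ ≤ n := by simpa using hp
  have h := unitIntegral_derivative_sq_le hdeg
  simp only [unitIntegral_apply, eval_pow, derivative_comp, eval_mul, eval_comp, derivative_C_mul,
    derivative_X, eval_C, eval_X, mul_one, mul_pow] at h
  rw [intervalIntegral.integral_const_mul,
    intervalIntegral.integral_comp_mul_left (fun t ↦ (derivative p).eval t ^ 2) hL.ne',
    intervalIntegral.integral_comp_mul_left (fun t ↦ p.eval t ^ 2) hL.ne'] at h
  simp only [mul_zero, mul_one, smul_eq_mul] at h
  have hn' : (1 : ℝ) ≤ n := by exact_mod_cast hn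
  have h16 : ((n : ℝ) + 1) ^ 4 ≤ 16 * n ^ 4 := by
    calc ((n : ℝ) + 1) ^ 4 ≤ (2 * n) ^ 4 := by gcongr; linarith
      _ = _ := by ring
  have hI : 0 ≤ ∫ t in (0 : ℝ)..L, p.eval t ^ 2 :=
    intervalIntegral.integral_nonneg hL.le fun t _ ↦ sq_nonneg _
  refine le_of_mul_le_mul_left ?_ (inv_pos.2 hL)
  calc _ = L ^ 2 * (L⁻¹ * ∫ t in (0 : ℝ)..L, (derivative p).eval t ^ 2) := by ring
    _ ≤ _ := h
    _ ≤ 16 * n ^ 4 * (L⁻¹ * ∫ t in (0 : ℝ)..L, p.eval t ^ 2) := by gcongr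
    _ = _ := by ring

end Polynomial
/-- The standard closed unit simplex in `ℝᵈ`. -/
def unitSimplex (d : ℕ) : Set (Fin d → ℝ) := {x | (∀ i, 0 ≤ x i) ∧ ∑ i, x i ≤ 1}

theorem isCompact_unitSimplex (d : ℕ) : IsCompact (unitSimplex d) := by
  refine (isCompact_Icc (a := (0 : Fin d → ℝ)) (b := 1)).of_isClosed_subset ?_ ?_
  · simp only [unitSimplex, Set.ofPred_and, Set.ofPred_forall]
    exact (isClosed_iInter fun i ↦ isClosed_le continuous_const (continuous_apply i)).inter
      (isClosed_le (by fun_prop) continuous_const)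
  · rintro x ⟨h₀, h₁⟩
    exact ⟨h₀, fun i ↦
      (Finset.single_le_sum (fun j _ ↦ h₀ j) (Finset.mem_univ i)).trans h₁⟩

theorem Continuous.integrableOn_unitSimplex {d : ℕ} {g : (Fin d → ℝ) → ℝ} (hg : Continuous g) :
    IntegrableOn g (unitSimplex d) :=
  hg.continuousOn.integrableOn_compact (isCompact_unitSimplex d)

theorem insertNth_mem_unitSimplex {n : ℕ} (i : Fin (n + 1)) (t : ℝ) (y : Fin n → ℝ) :
    (i.insertNth t y : Fin (n + 1) → ℝ) ∈ unitSimplex (n + 1) ↔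
      y ∈ unitSimplex n ∧ t ∈ Set.Icc 0 (1 - ∑ j, y j) := by
  simp only [unitSimplex, Set.mem_ofPred_eq, i.forall_iff_succAbove, Fin.sum_univ_succAbove _ i,
    Fin.insertNth_apply_same, Fin.insertNth_apply_succAbove, Set.mem_Icc]
  constructor
  · rintro ⟨⟨h₀, h₁⟩, h₂⟩
    exact ⟨⟨h₁, by linarith⟩, h₀, by linarith⟩
  · rintro ⟨⟨h₁, -⟩, h₀, h₂⟩
    exact ⟨⟨h₀, h₁⟩, by linarith⟩

theorem integral_indicator_unitSimplex_insertNth {n : ℕ} (i : Fin (n + 1))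
    (g : (Fin (n + 1) → ℝ) → ℝ) (y : Fin n → ℝ) :
    ∫ t, (unitSimplex (n + 1)).indicator g (i.insertNth t y) =
      (unitSimplex n).indicator
        (fun y ↦ ∫ t in (0 : ℝ)..(1 - ∑ j, y j), g (i.insertNth t y)) y := by
  by_cases hy : y ∈ unitSimplex n
  · rw [Set.indicator_of_mem hy, intervalIntegral.integral_of_le (by linarith [hy.2]),
      ← integral_Icc_eq_integral_Ioc, ← integral_indicator measurableSet_Icc]
    congr 1 with t
    by_cases ht : t ∈ Set.Icc 0 (1 - ∑ j, y j)
    · rw [Set.indicator_of_mem ((insertNth_mem_unitSimplex i t y).2 ⟨hy, ht⟩),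
        Set.indicator_of_mem ht]
    · rw [Set.indicator_of_notMem fun h ↦ ht ((insertNth_mem_unitSimplex i t y).1 h).2,
        Set.indicator_of_notMem ht]
  · rw [Set.indicator_of_notMem hy, ← integral_zero ℝ ℝ]
    congr 1 with t
    exact Set.indicator_of_notMem (fun h ↦ hy ((insertNth_mem_unitSimplex i t y).1 h).1) g

theorem integrable_prod_indicator_unitSimplex {n : ℕ} (i : Fin (n + 1))
    {g : (Fin (n + 1) → ℝ) → ℝ} (hg : Continuous g) :
    Integrable (fun z : ℝ × (Fin n → ℝ) ↦
      (unitSimplex (n + 1)).indicator g (i.insertNth z.1 z.2)) (volume.prod volume) := by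
  have hint := (integrable_indicator_iff (isCompact_unitSimplex _).measurableSet).2
    hg.integrableOn_unitSimplex
  exact ((volume_preserving_piFinSuccAbove (fun _ ↦ ℝ) i).symm.integrable_comp_emb
    (MeasurableEquiv.measurableEmbedding _)).2 hint

theorem setIntegral_unitSimplex_succ {n : ℕ} (i : Fin (n + 1))
    {g : (Fin (n + 1) → ℝ) → ℝ} (hg : Continuous g) :
    ∫ x in unitSimplex (n + 1), g x =
      ∫ y in unitSimplex n, ∫ t in (0 : ℝ)..(1 - ∑ j, y j), g (i.insertNth t y) := by
  rw [← integral_indicator (isCompact_unitSimplex _).measurableSet,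
    ← (volume_preserving_piFinSuccAbove (fun _ ↦ ℝ) i).symm.integral_comp
      (MeasurableEquiv.measurableEmbedding _),
    ← integral_indicator (isCompact_unitSimplex _).measurableSet]
  simp_rw [← integral_indicator_unitSimplex_insertNth]
  exact integral_prod_symm _ (integrable_prod_indicator_unitSimplex i hg)

theorem integrableOn_unitSimplex_intervalIntegral {n : ℕ} (i : Fin (n + 1))
    {g : (Fin (n + 1) → ℝ) → ℝ} (hg : Continuous g) :
    IntegrableOn (fun y ↦ ∫ t in (0 : ℝ)..(1 - ∑ j, y j), g (i.insertNth t y))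
      (unitSimplex n) := by
  rw [← integrable_indicator_iff (isCompact_unitSimplex _).measurableSet]
  refine (integrable_prod_indicator_unitSimplex i hg).integral_prod_right.congr ?_
  exact .of_forall fun y ↦ integral_indicator_unitSimplex_insertNth i g y

open Polynomial in
/-- A `C¹` function whose restriction to every line is a polynomial of degree at most `l`. -/
structure IsPolynomialOnLines_s9 {d : ℕ} (l : ℕ) (f : (Fin d → ℝ) → ℝ) : Prop where
  contDiff : ContDiff ℝ 1 f
  exists_polynomial (x w : Fin d → ℝ) :
    ∃ p : ℝ[X], p.natDegree ≤ l ∧ ∀ t : ℝ, f (x + t • w) = p.eval t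

theorem IsPolynomialOnLines_s9.continuous_fderiv_apply {d l : ℕ} {f : (Fin d → ℝ) → ℝ}
    (hf : IsPolynomialOnLines_s9 l f) (w : Fin d → ℝ) : Continuous fun x ↦ fderiv ℝ f x w :=
  (hf.contDiff.continuous_fderiv one_ne_zero).clm_apply continuous_const

theorem isPolynomialOnLines_eval {d l : ℕ} {v : MvPolynomial (Fin d) ℝ}
    (hv : v.totalDegree ≤ l) : IsPolynomialOnLines_s9 l fun x ↦ MvPolynomial.eval x v where
  contDiff := (AnalyticOnNhd.eval_mvPolynomial v).contDiff
  exists_polynomial x w := by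
    refine ⟨MvPolynomial.aeval (fun i ↦ Polynomial.C (x i) + Polynomial.X * Polynomial.C (w i)) v,
      ?_, fun t ↦ ?_⟩
    · refine (MvPolynomial.aeval_natDegree_le v hv _ (n := 1) fun i ↦ ?_).trans (by simp)
      compute_degree
    · rw [← Polynomial.coe_evalRingHom, MvPolynomial.map_aeval]
      change MvPolynomial.eval₂Hom _ _ v = _
      congr 2
      · ext
        simp
      · ext i
        simp
        ring

theorem IsPolynomialOnLines_s9.comp_add {d l : ℕ} {f : (Fin d → ℝ) → ℝ}
    (hf : IsPolynomialOnLines_s9 l f) (A : (Fin d → ℝ) →L[ℝ] (Fin d → ℝ)) (b : Fin d → ℝ) :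
    IsPolynomialOnLines_s9 l fun x ↦ f (A x + b) where
  contDiff := hf.contDiff.comp (A.contDiff.add contDiff_const)
  exists_polynomial x w := by
    obtain ⟨p, hp, h⟩ := hf.exists_polynomial (A x + b) (A w)
    refine ⟨p, hp, fun t ↦ ?_⟩
    rw [← h, map_add, map_smul, add_right_comm]

theorem fderiv_eval_mvPolynomial_single {d : ℕ} (v : MvPolynomial (Fin d) ℝ) (x : Fin d → ℝ)
    (i : Fin d) :
    fderiv ℝ (fun x ↦ MvPolynomial.eval x v) x (Pi.single i 1) =
      MvPolynomial.eval x (MvPolynomial.pderiv i v) := by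
  have hdiff (q : MvPolynomial (Fin d) ℝ) :
      DifferentiableAt ℝ (fun x ↦ MvPolynomial.eval x q) x :=
    (isPolynomialOnLines_eval le_rfl).contDiff.differentiable one_ne_zero x
  induction v using MvPolynomial.induction_on with
  | C a => simp
  | add p q hp hq =>
    simp only [map_add]
    rw [fderiv_fun_add (hdiff p) (hdiff q), add_apply, hp, hq]
  | mul_X p j hp =>
    have hX : fderiv ℝ (fun x : Fin d → ℝ ↦ x j) x (Pi.single i 1) =
        (Pi.single i 1 : Fin d → ℝ) j := by
      rw [(hasFDerivAt_apply j x).fderiv]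
      rfl
    simp only [map_mul, MvPolynomial.eval_X]
    rw [fderiv_fun_mul (hdiff p) (by fun_prop), MvPolynomial.pderiv_mul]
    by_cases hij : j = i
    · subst hij
      simp [hp, hX]
      ring
    · simp [hp, hX, hij, mul_comm]

/-- Slice-wise Markov inequality, weighted by the barycentric coordinate of the origin. -/
theorem IsPolynomialOnLines_s9.setIntegral_weight_mul_fderiv_single_sq_le {d l : ℕ} (hl : 1 ≤ l)
    {f : (Fin d → ℝ) → ℝ} (hf : IsPolynomialOnLines_s9 l f) (i : Fin d) :
    ∫ x in unitSimplex d, (1 - ∑ j, x j) ^ 2 * fderiv ℝ f x (Pi.single i 1) ^ 2 ≤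
      16 * l ^ 4 * ∫ x in unitSimplex d, f x ^ 2 := by
  obtain ⟨n, rfl⟩ : ∃ n, d = n + 1 := Nat.exists_eq_succ_of_ne_zero (Fin.pos i).ne'
  have hD := hf.continuous_fderiv_apply (Pi.single i 1)
  have hw : Continuous fun x : Fin (n + 1) → ℝ ↦
      (1 - ∑ j, x j) ^ 2 * fderiv ℝ f x (Pi.single i 1) ^ 2 := by fun_prop
  have hf2 : Continuous fun x ↦ f x ^ 2 := hf.contDiff.continuous.pow 2
  rw [setIntegral_unitSimplex_succ i hw, setIntegral_unitSimplex_succ i hf2,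
    ← integral_const_mul]
  refine setIntegral_mono_on (integrableOn_unitSimplex_intervalIntegral i hw)
    ((integrableOn_unitSimplex_intervalIntegral i hf2).const_mul _)
    (isCompact_unitSimplex n).measurableSet fun y hy ↦ ?_
  have hL : 0 ≤ 1 - ∑ j, y j := by linarith [hy.2]
  have hline (t : ℝ) : (i.insertNth t y : Fin (n + 1) → ℝ) =
      i.insertNth 0 y + t • Pi.single i 1 := by
    ext j
    induction j using i.succAboveCases <;> simp
  obtain ⟨p, hp, h⟩ := hf.exists_polynomial (i.insertNth 0 y) (Pi.single i 1)
  have hder (t : ℝ) :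
      fderiv ℝ f (i.insertNth t y) (Pi.single i 1) = (Polynomial.derivative p).eval t := by
    have h₁ : HasDerivAt (fun t : ℝ ↦ f (i.insertNth 0 y + t • Pi.single i 1))
        (fderiv ℝ f (i.insertNth t y) (Pi.single i 1)) t := by
      have h₂ : HasDerivAt (fun t : ℝ ↦ (i.insertNth 0 y + t • Pi.single i 1 : Fin (n + 1) → ℝ))
          (Pi.single i 1) t := by
        simpa using ((hasDerivAt_id t).smul_const (Pi.single i 1 : Fin (n + 1) → ℝ)).const_add
          (i.insertNth 0 y : Fin (n + 1) → ℝ)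
      rw [hline t]
      exact (hf.contDiff.differentiable one_ne_zero _).hasFDerivAt.comp_hasDerivAt t h₂
    simp only [h] at h₁
    exact h₁.unique (p.hasDerivAt t)
  have hval (t : ℝ) : f (i.insertNth t y) = p.eval t := by rw [hline, h]
  simp only [hder, hval]
  refine le_trans ?_ (Polynomial.integral_derivative_sq_le hl hp hL)
  rw [← intervalIntegral.integral_const_mul]
  refine intervalIntegral.integral_mono_on hL ?_ ?_ fun t ht ↦ ?_
  · exact Continuous.intervalIntegrable (by fun_prop) _ _
  · exact Continuous.intervalIntegrable (by fun_prop) _ _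
  · have hs : ∑ j, (i.insertNth t y : Fin (n + 1) → ℝ) j = t + ∑ j, y j := by
      simp [Fin.sum_univ_succAbove _ i]
    rw [hs]
    gcongr
    · linarith [ht.2]
    · linarith [ht.1]

/-- The linear part of the affine involution of the unit simplex exchanging the origin with the
`m`-th vertex. -/
noncomputable def vertexSwapLinear {d : ℕ} (m : Fin d) : (Fin d → ℝ) →L[ℝ] (Fin d → ℝ) where
  toFun x := x - (x m + ∑ j, x j) • Pi.single m 1
  map_add' x y := by
    simp only [Pi.add_apply, Finset.sum_add_distrib]
    module
  map_smul' c x := by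
    simp only [Pi.smul_apply, smul_eq_mul, ← Finset.mul_sum, RingHom.id_apply]
    module
  cont := by fun_prop

theorem vertexSwapLinear_apply {d : ℕ} (m : Fin d) (x : Fin d → ℝ) :
    vertexSwapLinear m x = x - (x m + ∑ j, x j) • Pi.single m 1 :=
  rfl

theorem sum_vertexSwapLinear {d : ℕ} (m : Fin d) (x : Fin d → ℝ) :
    ∑ j, vertexSwapLinear m x j = -x m := by
  simp [vertexSwapLinear_apply, Pi.single_apply]

theorem vertexSwapLinear_vertexSwapLinear {d : ℕ} (m : Fin d) (x : Fin d → ℝ) :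
    vertexSwapLinear m (vertexSwapLinear m x) = x := by
  rw [vertexSwapLinear_apply, sum_vertexSwapLinear, vertexSwapLinear_apply]
  ext j
  simp
  ring

/-- The affine involution of the unit simplex exchanging the origin with the `m`-th vertex. -/
noncomputable def vertexSwap {d : ℕ} (m : Fin d) (x : Fin d → ℝ) : Fin d → ℝ :=
  vertexSwapLinear m x + Pi.single m 1

theorem vertexSwap_apply {d : ℕ} (m : Fin d) (x : Fin d → ℝ) (j : Fin d) :
    vertexSwap m x j = if j = m then 1 - ∑ k, x k else x j := by
  simp only [vertexSwap, vertexSwapLinear_apply, Pi.add_apply, Pi.sub_apply, Pi.smul_apply,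
    Pi.single_apply, smul_eq_mul]
  split_ifs with h
  · rw [h]; ring
  · ring

theorem sum_vertexSwap {d : ℕ} (m : Fin d) (x : Fin d → ℝ) :
    ∑ j, vertexSwap m x j = 1 - x m := by
  simp only [vertexSwap, Pi.add_apply, Finset.sum_add_distrib, sum_vertexSwapLinear]
  simp
  ring

theorem vertexSwap_involutive {d : ℕ} (m : Fin d) : Function.Involutive (vertexSwap m) := by
  intro x
  ext j
  rw [vertexSwap_apply, sum_vertexSwap, vertexSwap_apply]
  split_ifs with h
  · rw [h]; ring
  · rfl

theorem vertexSwap_mem_unitSimplex {d : ℕ} (m : Fin d) {x : Fin d → ℝ} (hx : x ∈ unitSimplex d) :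
    vertexSwap m x ∈ unitSimplex d := by
  refine ⟨fun j ↦ ?_, by linarith [sum_vertexSwap m x, hx.1 m]⟩
  rw [vertexSwap_apply]
  split_ifs
  · linarith [hx.2]
  · exact hx.1 j

theorem measurePreserving_vertexSwap {d : ℕ} (m : Fin d) :
    MeasurePreserving (vertexSwap m) := by
  have hlin : MeasurePreserving (vertexSwapLinear m) := by
    refine ⟨(vertexSwapLinear m).continuous.measurable, ?_⟩
    have hdet : LinearMap.det (vertexSwapLinear m : (Fin d → ℝ) →ₗ[ℝ] (Fin d → ℝ)) ^ 2 = 1 := by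
      rw [sq, ← LinearMap.det_comp]
      convert LinearMap.det_id
      exact LinearMap.ext fun x ↦ vertexSwapLinear_vertexSwapLinear m x
    have habs : |LinearMap.det (vertexSwapLinear m : (Fin d → ℝ) →ₗ[ℝ] (Fin d → ℝ))| = 1 := by
      simpa using sq_eq_sq_iff_abs_eq_abs _ _ |>.1 (hdet.trans (one_pow 2).symm)
    have h := Real.map_linearMap_volume_pi_eq_smul_volume_pi
      (f := (vertexSwapLinear m : (Fin d → ℝ) →ₗ[ℝ] (Fin d → ℝ))) (by rintro h; simp [h] at hdet)
    rw [abs_inv, habs] at h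
    simpa using h
  exact (measurePreserving_add_right volume (Pi.single m 1)).comp hlin

theorem setIntegral_unitSimplex_comp_vertexSwap {d : ℕ} (m : Fin d) (g : (Fin d → ℝ) → ℝ) :
    ∫ x in unitSimplex d, g (vertexSwap m x) = ∫ x in unitSimplex d, g x := by
  have hpre : vertexSwap m ⁻¹' unitSimplex d = unitSimplex d := by
    ext x
    refine ⟨fun hx ↦ ?_, vertexSwap_mem_unitSimplex m⟩
    simpa only [vertexSwap_involutive m x] using vertexSwap_mem_unitSimplex m hx
  have hemb : MeasurableEmbedding (vertexSwap m) :=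
    (MeasurableEquiv.ofInvolutive _ (vertexSwap_involutive m)
      (measurePreserving_vertexSwap m).measurable).measurableEmbedding
  have h := (measurePreserving_vertexSwap m).setIntegral_preimage_emb hemb g (unitSimplex d)
  rwa [hpre] at h

theorem IsPolynomialOnLines_s9.setIntegral_coord_mul_fderiv_sq_le {d l : ℕ} (hl : 1 ≤ l)
    {f : (Fin d → ℝ) → ℝ} (hf : IsPolynomialOnLines_s9 l f) (m i : Fin d) :
    ∫ x in unitSimplex d, x m ^ 2 * fderiv ℝ f x (vertexSwapLinear m (Pi.single i 1)) ^ 2 ≤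
      16 * l ^ 4 * ∫ x in unitSimplex d, f x ^ 2 := by
  have hswap : IsPolynomialOnLines_s9 l fun x ↦ f (vertexSwap m x) :=
    hf.comp_add (vertexSwapLinear m) (Pi.single m 1)
  have h := hswap.setIntegral_weight_mul_fderiv_single_sq_le hl i
  have hder (x : Fin d → ℝ) :
      fderiv ℝ (fun x ↦ f (vertexSwap m x)) x =
        (fderiv ℝ f (vertexSwap m x)).comp (vertexSwapLinear m) :=
    ((hf.contDiff.differentiable one_ne_zero _).hasFDerivAt.comp x
      ((vertexSwapLinear m).hasFDerivAt.add_const _)).fderiv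
  rw [← setIntegral_unitSimplex_comp_vertexSwap m, ← setIntegral_unitSimplex_comp_vertexSwap m
    (fun x ↦ f x ^ 2)]
  simpa only [hder, ContinuousLinearMap.comp_apply, vertexSwap_apply, if_true] using h

theorem sq_apply_single_le {d : ℕ} (D : (Fin d → ℝ) →L[ℝ] ℝ) (m i : Fin d) :
    D (Pi.single i 1) ^ 2 ≤ 2 * (D (vertexSwapLinear m (Pi.single i 1)) ^ 2 +
      D (vertexSwapLinear m (Pi.single m 1)) ^ 2) := by
  have hs (k : Fin d) : D (vertexSwapLinear m (Pi.single k 1)) =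
      D (Pi.single k 1) - ((if m = k then 1 else 0) + 1) * D (Pi.single m 1) := by
    rw [vertexSwapLinear_apply, map_sub, map_smul]
    simp [Pi.single_apply]
  rw [hs, hs, if_pos rfl]
  split_ifs with h
  · subst h
    nlinarith [sq_nonneg (D (Pi.single m 1))]
  · nlinarith [sq_nonneg (D (Pi.single i 1) - 2 * D (Pi.single m 1))]

theorem IsPolynomialOnLines_s9.setIntegral_fderiv_single_sq_le {d l : ℕ} (hl : 1 ≤ l)
    {f : (Fin d → ℝ) → ℝ} (hf : IsPolynomialOnLines_s9 l f) (i : Fin d) :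
    ∫ x in unitSimplex d, fderiv ℝ f x (Pi.single i 1) ^ 2 ≤
      16 * (d + 1) * (4 * d + 1) * l ^ 4 * ∫ x in unitSimplex d, f x ^ 2 := by
  have hD := hf.continuous_fderiv_apply
  set J := ∫ x in unitSimplex d, f x ^ 2
  let W (x : Fin d → ℝ) : ℝ := (1 - ∑ j, x j) ^ 2 * fderiv ℝ f x (Pi.single i 1) ^ 2
  let G (m k : Fin d) (x : Fin d → ℝ) : ℝ :=
    x m ^ 2 * fderiv ℝ f x (vertexSwapLinear m (Pi.single k 1)) ^ 2
  have hW : Continuous W := by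
    have := hD (Pi.single i 1)
    fun_prop
  have hG (m k : Fin d) : Continuous (G m k) := by
    have := hD (vertexSwapLinear m (Pi.single k 1))
    fun_prop
  have hpt (x : Fin d → ℝ) : fderiv ℝ f x (Pi.single i 1) ^ 2 ≤
      (d + 1) * (W x + ∑ m, 2 * (G m i x + G m m x)) := by
    set D := fderiv ℝ f x
    have hone : (1 : ℝ) ≤ (d + 1) * ((1 - ∑ j, x j) ^ 2 + ∑ m, x m ^ 2) := by
      have := sq_sum_le_card_mul_sum_sq (s := Finset.univ)
        (f := (Fin.cons (1 - ∑ j, x j) x : Fin (d + 1) → ℝ))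
      simpa [Fin.sum_univ_succ] using this
    calc D (Pi.single i 1) ^ 2 = 1 * D (Pi.single i 1) ^ 2 := (one_mul _).symm
      _ ≤ ((d + 1) * ((1 - ∑ j, x j) ^ 2 + ∑ m, x m ^ 2)) * D (Pi.single i 1) ^ 2 := by gcongr
      _ = (d + 1) * (W x + ∑ m, x m ^ 2 * D (Pi.single i 1) ^ 2) := by
        rw [← Finset.sum_mul]; simp only [W, D]; ring
      _ ≤ _ := by
        refine mul_le_mul_of_nonneg_left ?_ (by positivity)
        refine add_le_add_right (Finset.sum_le_sum fun m _ ↦ ?_) _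
        calc _ ≤ x m ^ 2 * (2 * (D (vertexSwapLinear m (Pi.single i 1)) ^ 2 +
              D (vertexSwapLinear m (Pi.single m 1)) ^ 2)) := by
              gcongr; exact sq_apply_single_le D m i
          _ = _ := by simp only [G, D]; ring
  calc ∫ x in unitSimplex d, fderiv ℝ f x (Pi.single i 1) ^ 2
      ≤ ∫ x in unitSimplex d, (d + 1) * (W x + ∑ m, 2 * (G m i x + G m m x)) :=
        setIntegral_mono ((hD _).pow 2).integrableOn_unitSimplex
          (Continuous.integrableOn_unitSimplex (by fun_prop)) hpt
    _ = (d + 1) * ((∫ x in unitSimplex d, W x) + ∑ m, 2 * ((∫ x in unitSimplex d, G m i x) +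
          ∫ x in unitSimplex d, G m m x)) := by
        rw [integral_const_mul, integral_add hW.integrableOn_unitSimplex
          (Continuous.integrableOn_unitSimplex (by fun_prop)), integral_finsetSum _
          fun m _ ↦ Continuous.integrableOn_unitSimplex (by fun_prop)]
        simp_rw [integral_const_mul]
        congr! 5 with m
        exact integral_add (hG m i).integrableOn_unitSimplex (hG m m).integrableOn_unitSimplex
    _ ≤ (d + 1) * (16 * l ^ 4 * J + ∑ m : Fin d, 2 * (16 * l ^ 4 * J + 16 * l ^ 4 * J)) := by
        gcongr with m
        · exact hf.setIntegral_weight_mul_fderiv_single_sq_le hl i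
        · exact hf.setIntegral_coord_mul_fderiv_sq_le hl m i
        · exact hf.setIntegral_coord_mul_fderiv_sq_le hl m m
    _ = _ := by
        simp only [Finset.sum_const, Finset.card_univ, Fintype.card_fin, nsmul_eq_mul]; ring

/-- **H¹–L² polynomial inverse inequality** (reference-element form of Lemma 4.2).
For every dimension `d ≥ 1` there is `C > 0` depending only on `d` such that for every
`ℓ ≥ 1` and every real polynomial `v` in `d` variables of total degree at most `ℓ`,
`∫_{Δ_d} ‖∇v‖² dx ≤ C ℓ⁴ ∫_{Δ_d} v² dx`, where `Δ_d` is the standard unit simplex in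
`ℝᵈ`, `‖∇v(x)‖²` is the squared Euclidean norm of the gradient, i.e. the sum of the
squared partial derivatives, and `dx` is the Lebesgue measure. -/
theorem h1_l2_polynomial_inverse_inequality (d : ℕ) (hd : 1 ≤ d) :
    ∃ C : ℝ, 0 < C ∧
      ∀ l : ℕ, 1 ≤ l → ∀ v : MvPolynomial (Fin d) ℝ, v.totalDegree ≤ l →
        (∫ x in {x : Fin d → ℝ | (∀ i, 0 ≤ x i) ∧ ∑ i, x i ≤ 1},
            ∑ i, (MvPolynomial.eval x (MvPolynomial.pderiv i v)) ^ 2) ≤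
          C * (l : ℝ) ^ 4 *
            ∫ x in {x : Fin d → ℝ | (∀ i, 0 ≤ x i) ∧ ∑ i, x i ≤ 1},
              (MvPolynomial.eval x v) ^ 2 := by
  refine ⟨d * (16 * (d + 1) * (4 * d + 1)), by positivity, fun l hl v hv ↦ ?_⟩
  have hf := isPolynomialOnLines_eval hv
  change ∫ x in unitSimplex d, _ ≤ _ * ∫ x in unitSimplex d, _
  simp_rw [← fderiv_eval_mvPolynomial_single]
  have hD (i : Fin d) := hf.continuous_fderiv_apply (Pi.single i 1)
  rw [integral_finsetSum _ fun i _ ↦ Continuous.integrableOn_unitSimplex (by fun_prop)]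
  refine (Finset.sum_le_sum fun i _ ↦ hf.setIntegral_fderiv_single_sq_le hl i).trans_eq ?_
  simp only [Finset.sum_const, Finset.card_univ, Fintype.card_fin, nsmul_eq_mul]
  ring
end
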